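/- arXiv:2104.02582 — 2 statements merged into one kernel-verified Lean document; each statement's English description precedes it below -/
import Mathlib

section
/- Let n > 2 be a prime such that 4n² − 27 is squarefree, and let α be a root of g_n(x) = x³ − n·x² + n. Then g_n is irreducible over ℚ, K = ℚ(α) is a totally real cubic field which is not Galois over ℚ, and the discriminant of K equals n²·(4n² − 27). -/
open Polynomial NumberField

/-- The polynomial `x³ − n·x² + n` over a commutative ring. -/
noncomputable def cubicPoly (R : Type*) [CommRing R] (n : ℕ) : R[X] :=
  X ^ 3 - C (n : R) * X ^ 2 + C (n : R)

namespace cubicPoly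

variable {R S : Type*} [CommRing R] [CommRing S] (n : ℕ)

theorem map (f : R →+* S) : (cubicPoly R n).map f = cubicPoly S n := by
  simp [cubicPoly]

theorem natDegree [Nontrivial R] : (cubicPoly R n).natDegree = 3 := by
  unfold cubicPoly; compute_degree!

theorem monic : (cubicPoly R n).Monic := by
  unfold cubicPoly; monicity!

theorem eval₂_eq (f : R →+* S) (x : S) :
    (cubicPoly R n).eval₂ f x = x ^ 3 - (n : S) * x ^ 2 + (n : S) := by
  simp [cubicPoly]

theorem isEisensteinAt {n : ℕ} (hn : n.Prime) :
    (cubicPoly ℤ n).IsEisensteinAt (Submodule.span ℤ {(n : ℤ)}) := by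
  refine (monic n).isEisensteinAt_of_mem_of_notMem ?_ ?_ ?_
  · rw [Ne, Ideal.span_singleton_eq_top]
    exact (Nat.prime_iff_prime_int.mp hn).not_isUnit
  · intro i hi
    rw [natDegree] at hi
    rw [Ideal.mem_span_singleton]
    interval_cases i <;> simp [cubicPoly, coeff_X_pow]
  · rw [Ideal.span_singleton_pow, Ideal.mem_span_singleton]
    have h1 : (cubicPoly ℤ n).coeff 0 = n := by simp [cubicPoly, coeff_X_pow]
    rw [h1]
    intro h
    have h2 : n ^ 2 ∣ n := by exact_mod_cast h
    have := Nat.le_of_dvd hn.pos h2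
    nlinarith [hn.two_le]

theorem irreducible_int {n : ℕ} (hn : n.Prime) : Irreducible (cubicPoly ℤ n) := by
  refine (isEisensteinAt hn).irreducible ?_ (monic n).isPrimitive (by simp [natDegree])
  rw [Ideal.span_singleton_prime (by exact_mod_cast hn.ne_zero)]
  exact Nat.prime_iff_prime_int.mp hn

theorem irreducible_rat {n : ℕ} (hn : n.Prime) : Irreducible (cubicPoly ℚ n) := by
  rw [← map n (algebraMap ℤ ℚ)]
  exact (monic n).irreducible_iff_irreducible_map_fraction_map.mp (irreducible_int hn)

theorem conj_eq_self_of_root {n : ℕ} (hn : 2 < n) {z : ℂ}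
    (hz : z ^ 3 - (n : ℂ) * z ^ 2 + (n : ℂ) = 0) : (starRingEnd ℂ) z = z := by
  rw [Complex.conj_eq_iff_im]
  by_contra hy
  obtain ⟨x, y⟩ := z
  have hn' : (3 : ℝ) ≤ n := by exact_mod_cast hn
  have hre := congrArg Complex.re hz
  have him := congrArg Complex.im hz
  simp [pow_succ] at hre him hy
  have h1 : y ^ 2 = 3 * x ^ 2 - 2 * n * x := by
    apply mul_left_cancel₀ hy; linear_combination -him
  have h2 : 2 * x * (2 * x - n) ^ 2 = n := by
    linear_combination (-1) * hre + (-3 * x + n) * h1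
  have hx : 0 < x := by
    by_contra! h
    nlinarith [mul_nonneg (neg_nonneg.mpr h) (sq_nonneg (2 * x - n))]
  have hy2 : 0 < y ^ 2 := by positivity
  have h3 : 2 * (n : ℝ) < 3 * x := by
    have : 0 < x * (3 * x - 2 * n) := by linarith
    linarith [(mul_pos_iff_of_pos_left hx).mp this]
  have h4 : (n / 3 : ℝ) ^ 2 ≤ (2 * x - n) ^ 2 := by gcongr; linarith
  nlinarith [sq_nonneg ((n : ℝ))]

/-- If `x³ − n·x² + n` splits over a field, its discriminant is a square there. -/
theorem exists_sq_eq_of_splits {K : Type*} [Field K] {n : ℕ} (h : (cubicPoly K n).Splits) :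
    ∃ δ : K, δ ^ 2 = (n : K) ^ 2 * (4 * (n : K) ^ 2 - 27) := by
  have hc : (cubicPoly K n).roots.card = 3 := by
    rw [← natDegree (R := K) n]; exact (splits_iff_card_roots.mp h)
  obtain ⟨a, b, c, habc⟩ := Multiset.card_eq_three.mp hc
  have hprod := h.eq_prod_roots_of_monic (monic n)
  rw [habc] at hprod
  simp at hprod
  have hexp : cubicPoly K n =
      X ^ 3 - C (a + b + c) * X ^ 2 + C (a * b + b * c + c * a) * X - C (a * b * c) := by
    rw [hprod]; simp; ring
  have e0 := congrArg (coeff · 0) hexp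
  have e1 := congrArg (coeff · 1) hexp
  have e2 := congrArg (coeff · 2) hexp
  simp only [cubicPoly, coeff_add, coeff_sub, coeff_C_mul, coeff_X, coeff_C, coeff_X_pow]
    at e0 e1 e2
  norm_num at e0 e1 e2
  refine ⟨(a - b) * (b - c) * (c - a), ?_⟩
  have hs1 : a + b + c = n := by linear_combination e2
  have hs2 : a * b + b * c + c * a = 0 := by linear_combination -e1
  have hs3 : a * b * c = -n := by linear_combination e0
  have hid : ((a - b) * (b - c) * (c - a)) ^ 2 =
      (a + b + c) ^ 2 * (a * b + b * c + c * a) ^ 2 - 4 * (a * b + b * c + c * a) ^ 3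
      - 4 * (a + b + c) ^ 3 * (a * b * c) - 27 * (a * b * c) ^ 2
      + 18 * (a + b + c) * (a * b + b * c + c * a) * (a * b * c) := by ring
  rw [hid, hs1, hs2, hs3]
  ring

end cubicPoly

/-- If `f` annihilates the quotient of `𝓞 K` by the span of a family `a` whose discriminant is
`m * f`, with `f` squarefree and prime to `m`, then `a` has the discriminant of `K`. -/
theorem NumberField.discr_eq_of_smul_mem_span {K ι : Type*} [Field K] [NumberField K] [Fintype ι]
    [DecidableEq ι] (b : Module.Basis ι ℤ (𝓞 K)) (a : ι → 𝓞 K) {m f : ℤ} (hf : Squarefree f)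
    (hmf : IsCoprime f m) (hd : Algebra.discr ℤ a = m * f)
    (ha : ∀ z : 𝓞 K, f • z ∈ Submodule.span ℤ (Set.range a)) : discr K = m * f := by
  have hN : ∀ i, ∃ c : ι → ℤ, ∑ j, c j • a j = f • b i := fun i ↦
    (Submodule.mem_span_range_iff_exists_fun ℤ).mp (ha (b i))
  choose N hN using hN
  have hMN : b.toMatrix a * (Matrix.of N).transpose = f • (1 : Matrix ι ι ℤ) := by
    ext i j
    have h := congrArg (fun z ↦ b.repr z i) (hN j)
    simp only [map_sum, map_smul, Finsupp.coe_finsetSum, Finset.sum_apply, Finsupp.smul_apply,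
      smul_eq_mul, b.repr_self] at h
    simp only [Matrix.mul_apply, Module.Basis.toMatrix_apply, Matrix.transpose_apply,
      Matrix.of_apply, Matrix.smul_apply, Matrix.one_apply, smul_eq_mul, mul_comm _ (N _ _), h,
      Finsupp.single_apply, eq_comm]
  have hdet : (b.toMatrix a).det ∣ f ^ Fintype.card ι :=
    ⟨_, by rw [← Matrix.det_mul, hMN, Matrix.det_smul, Matrix.det_one, mul_one]⟩
  have hcop : IsCoprime (b.toMatrix a).det m := (hmf.pow_left).of_isCoprime_of_dvd_left hdet
  have hda : Algebra.discr ℤ a = (b.toMatrix a).det ^ 2 * discr K := by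
    rw [← discr_eq_discr K b, ← Algebra.discr_of_matrix_vecMul]
    congr 1
    ext1 i
    simp [Matrix.vecMul, dotProduct, ← b.sum_toMatrix_smul_self a i, mul_comm]
  have hdvd : (b.toMatrix a).det ^ 2 ∣ f :=
    (hcop.pow_left).dvd_of_dvd_mul_left ⟨discr K, by rw [← hd, hda]⟩
  have hunit : IsUnit (b.toMatrix a).det := hf _ (by rwa [← sq])
  rw [← hd, hda, Int.isUnit_sq hunit, one_mul]

/-- The discriminant of the basis `1, θ, θ²` attached to a root `θ` of `x³ − n·x² + n`. -/
theorem discr_of_basis_eq_pow {K : Type*} [Field K] [Algebra ℚ K] {n : ℕ} {θ : K}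
    (B : Module.Basis (Fin 3) ℚ K) (hB : ∀ i, B i = θ ^ (i : ℕ))
    (hθ : θ ^ 3 - (n : K) * θ ^ 2 + (n : K) = 0) :
    Algebra.discr ℚ B = (n : ℚ) ^ 2 * (4 * (n : ℚ) ^ 2 - 27) := by
  have hM : Algebra.leftMulMatrix B θ = !![0, 0, -(n : ℚ); 1, 0, 0; 0, 1, (n : ℚ)] := by
    have h0 : θ * B 0 = B 1 := by simp [hB]
    have h1 : θ * B 1 = B 2 := by simp [hB]; ring
    have h2 : θ * B 2 = (n : ℚ) • B 2 - (n : ℚ) • B 0 := by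
      simp [hB, Algebra.smul_def]; linear_combination hθ
    ext i j
    rw [Algebra.leftMulMatrix_eq_repr_mul]
    fin_cases j <;> simp only [Fin.zero_eta, Fin.mk_one, Fin.reduceFinMk, h0, h1, h2] <;>
      fin_cases i <;> simp
  have htr (k : ℕ) : Algebra.trace ℚ K (θ ^ k) =
      Matrix.trace (!![0, 0, -(n : ℚ); 1, 0, 0; 0, 1, (n : ℚ)] ^ k) := by
    rw [Algebra.trace_eq_matrix_trace B, map_pow, hM]
  have hT : Algebra.traceMatrix ℚ B = !![3, (n : ℚ), n ^ 2; n, n ^ 2, n ^ 3 - 3 * n;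
      n ^ 2, n ^ 3 - 3 * n, n ^ 4 - 4 * n ^ 2] := by
    ext i j
    rw [Algebra.traceMatrix_apply, Algebra.traceForm_apply, hB, hB, ← pow_add, htr]
    fin_cases i <;> fin_cases j <;> simp [pow_succ, Matrix.trace_fin_three] <;> ring
  rw [Algebra.discr_def, hT, Matrix.det_fin_three]
  simp
  ring

section NumberField

variable {K : Type*} [Field K] {n : ℕ} {θ : 𝓞 K}

theorem cubicPoly.minpoly_eq {L : Type*} [Field L] [Algebra ℚ L] {x : L} (hn : n.Prime)
    (hx : x ^ 3 - (n : L) * x ^ 2 + (n : L) = 0) : minpoly ℚ x = cubicPoly ℚ n :=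
  (minpoly.eq_of_irreducible_of_monic (irreducible_rat hn) (by rw [aeval_def, eval₂_eq, hx])
    (monic n)).symm

theorem cubicPoly.mem_span_pow_of_mem_adjoin (hθ : θ ^ 3 - (n : 𝓞 K) * θ ^ 2 + (n : 𝓞 K) = 0)
    {z : 𝓞 K} (hz : (z : K) ∈ Algebra.adjoin ℤ {(θ : K)}) :
    z ∈ Submodule.span ℤ (Set.range fun i : Fin 3 ↦ θ ^ (i : ℕ)) := by
  rw [Algebra.adjoin_singleton_eq_range_aeval] at hz
  obtain ⟨p, hp⟩ := hz
  rw [PowerBasis.mem_span_pow']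
  refine ⟨p %ₘ cubicPoly ℤ n, ?_, ?_⟩
  · exact (degree_modByMonic_lt _ (monic n)).trans_eq <| by
      rw [degree_eq_natDegree (monic n).ne_zero, natDegree]
  · rw [aeval_modByMonic_eq_self_of_root (by rw [aeval_def, eval₂_eq, hθ])]
    apply RingOfIntegers.coe_injective
    refine hp.symm.trans ?_
    exact aeval_algebraMap_apply K θ p

theorem cubicPoly.discr_eq [NumberField K] (hn : n.Prime)
    (hsf : Squarefree (4 * (n : ℤ) ^ 2 - 27)) (hθ : θ ^ 3 - (n : 𝓞 K) * θ ^ 2 + (n : 𝓞 K) = 0)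
    (pb : PowerBasis ℚ K) (hpb : pb.gen = (θ : K)) :
    discr K = (n : ℤ) ^ 2 * (4 * (n : ℤ) ^ 2 - 27) := by
  have hθK : (θ : K) ^ 3 - (n : K) * (θ : K) ^ 2 + (n : K) = 0 := by
    simpa using congrArg (algebraMap (𝓞 K) K) hθ
  have hdim : pb.dim = 3 := by
    rw [← pb.natDegree_minpoly, hpb, minpoly_eq hn hθK, natDegree]
  have hint : IsIntegral ℤ pb.gen := hpb ▸ θ.isIntegral_coe
  have hminZ : minpoly ℤ pb.gen = cubicPoly ℤ n := by
    apply map_injective (algebraMap ℤ ℚ) Int.cast_injective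
    rw [← minpoly.isIntegrallyClosed_eq_field_fractions' ℚ hint, hpb, minpoly_eq hn hθK,
      cubicPoly.map]
  have hdisc' := discr_of_basis_eq_pow (pb.basis.reindex (finCongr hdim)) (by simp [hpb]) hθK
  have hdisc : Algebra.discr ℚ pb.basis = (n : ℚ) ^ 2 * (4 * (n : ℚ) ^ 2 - 27) := by
    rw [← hdisc', Module.Basis.coe_reindex, Algebra.discr_reindex]
  have hprime : Prime (n : ℤ) := Nat.prime_iff_prime_int.mp hn
  have hn3 : n ≠ 3 := by
    rintro rfl
    exact absurd (hsf 3 ⟨1, by norm_num⟩) (by norm_num [Int.isUnit_iff])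
  have hcop : IsCoprime (4 * (n : ℤ) ^ 2 - 27) ((n : ℤ) ^ 2) := by
    apply IsCoprime.pow_right
    have h3 : IsCoprime (3 : ℤ) n :=
      Nat.isCoprime_iff_coprime.mpr <| (Nat.coprime_primes Nat.prime_three hn).mpr hn3.symm
    have heq : 4 * (n : ℤ) ^ 2 - 27 = -3 ^ 3 + 4 * n * n := by ring
    rw [heq]
    exact (IsCoprime.pow_left (m := 3) h3).neg_left.add_mul_right_left (4 * n)
  let e : Module.Basis (Fin 3) ℤ (𝓞 K) := (RingOfIntegers.basis K).reindex <|
    Fintype.equivOfCardEq <| by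
      rw [← Module.finrank_eq_card_basis (RingOfIntegers.basis K), RingOfIntegers.rank,
        pb.finrank, hdim, Fintype.card_fin]
  refine NumberField.discr_eq_of_smul_mem_span e (fun i : Fin 3 ↦ θ ^ (i : ℕ)) hsf hcop ?_ ?_
  · apply Int.cast_injective (α := ℚ)
    rw [← eq_intCast (algebraMap ℤ ℚ), Algebra.discr_def, RingHom.map_det]
    push_cast
    rw [← hdisc', Algebra.discr_def]
    congr 1
    ext i j
    simp only [RingHom.mapMatrix_apply, Matrix.map_apply, Algebra.traceMatrix_apply,
      Algebra.traceForm_apply, eq_intCast, Algebra.coe_trace_int]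
    simp [hpb]
  · intro z
    apply mem_span_pow_of_mem_adjoin hθ
    rw [← hpb]
    have hz := Algebra.discr_mul_isIntegral_mem_adjoin ℚ hint z.isIntegral_coe
    refine mem_adjoin_of_smul_prime_pow_smul_of_minpoly_isEisensteinAt (K := ℚ) (n := 2) hprime
      hint (RingOfIntegers.isIntegral_coe _) ?_ (hminZ ▸ isEisensteinAt hn)
    convert hz using 1
    rw [hdisc]
    simp [Algebra.smul_def, mul_assoc, map_ofNat (algebraMap (𝓞 K) K)]

theorem cubicPoly.not_isGalois {L : Type*} [Field L] [Algebra ℚ L] {x : L} (hn : n.Prime)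
    (hn2 : 2 < n) (hsf : Squarefree (4 * (n : ℤ) ^ 2 - 27))
    (hx : x ^ 3 - (n : L) * x ^ 2 + (n : L) = 0) (hL : Module.finrank ℚ L = 3) :
    ¬ IsGalois ℚ L := by
  intro hG
  have : FiniteDimensional ℚ L := Module.finite_of_finrank_pos (by omega)
  have hs := Normal.splits (F := ℚ) (K := L) inferInstance x
  rw [minpoly_eq hn hx, cubicPoly.map] at hs
  obtain ⟨δ, hδ⟩ := exists_sq_eq_of_splits hs
  have := algebraRat.charZero L
  have hn0 : (n : L) ≠ 0 := by exact_mod_cast hn.ne_zero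
  set y := δ / n with hy
  have hy2 : y ^ 2 = 4 * (n : L) ^ 2 - 27 := by
    rw [hy]; field_simp; linear_combination hδ
  have hdvd : (minpoly ℚ y).natDegree ∣ 3 := hL ▸ minpoly.degree_dvd (IsIntegral.of_finite ℚ y)
  have hle : (minpoly ℚ y).natDegree ≤ 2 := by
    have hp : (X ^ 2 - C (4 * (n : ℚ) ^ 2 - 27)).natDegree = 2 := natDegree_X_pow_sub_C
    rw [← hp]
    refine natDegree_le_of_dvd (minpoly.dvd ℚ y (by simp [hy2])) ?_
    exact X_pow_sub_C_ne_zero two_pos _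
  have hone : (minpoly ℚ y).natDegree = 1 :=
    ((Nat.dvd_prime Nat.prime_three).mp hdvd).resolve_right (by omega)
  obtain ⟨q, hq⟩ := minpoly.natDegree_eq_one_iff.mp hone
  have hq2 : IsSquare (((4 * (n : ℤ) ^ 2 - 27 : ℤ)) : ℚ) := by
    refine ⟨q, (algebraMap ℚ L).injective ?_⟩
    rw [map_mul, hq, ← sq, hy2]
    simp
  obtain ⟨k, hk⟩ := Rat.isSquare_intCast_iff.mp hq2
  have hk1 := Int.isUnit_sq (hsf k (Dvd.intro_left 1 (by rw [one_mul, hk])))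
  have hn7 : n ^ 2 = 7 := by zify; linarith [sq k]
  have : n < 3 := by nlinarith
  omega

end NumberField

/-- Let `n > 2` be a prime with `4n² − 27` squarefree and `α` a root of
`gₙ(x) = x³ − n·x² + n`. Then `gₙ` is irreducible over `ℚ`, `K = ℚ(α)` is a totally real
cubic field that is not Galois over `ℚ`, and `D_K = n²·(4n² − 27)`. -/
theorem stmt8 (n : ℕ) (hprime : n.Prime) (hn : 2 < n)
    (hsf : Squarefree (4 * (n : ℤ) ^ 2 - 27))
    (α : ℂ) (hα : α ^ 3 - (n : ℂ) * α ^ 2 + (n : ℂ) = 0) :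
    Irreducible (X ^ 3 - C (n : ℚ) * X ^ 2 + C (n : ℚ)) ∧
    Module.finrank ℚ (IntermediateField.adjoin ℚ ({α} : Set ℂ)) = 3 ∧
    (∀ v : InfinitePlace (IntermediateField.adjoin ℚ ({α} : Set ℂ)), v.IsReal) ∧
    ¬ IsGalois ℚ (IntermediateField.adjoin ℚ ({α} : Set ℂ)) ∧
    ∃ hK : NumberField (IntermediateField.adjoin ℚ ({α} : Set ℂ)),
      @NumberField.discr (IntermediateField.adjoin ℚ ({α} : Set ℂ)) _ hK =
        (n : ℤ) ^ 2 * (4 * (n : ℤ) ^ 2 - 27) := by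
  have hint : IsIntegral ℚ α := ⟨_, cubicPoly.monic n, by rw [cubicPoly.eval₂_eq, hα]⟩
  have hfin : Module.finrank ℚ (IntermediateField.adjoin ℚ ({α} : Set ℂ)) = 3 := by
    rw [IntermediateField.adjoin.finrank hint, cubicPoly.minpoly_eq hprime hα,
      cubicPoly.natDegree]
  have hK : NumberField (IntermediateField.adjoin ℚ ({α} : Set ℂ)) :=
    { to_charZero := inferInstance
      to_finiteDimensional := Module.finite_of_finrank_pos (by omega) }
  have hgen : IntermediateField.AdjoinSimple.gen ℚ α ^ 3
      - (n : IntermediateField.adjoin ℚ ({α} : Set ℂ)) * IntermediateField.AdjoinSimple.gen ℚ α ^ 2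
      + (n : IntermediateField.adjoin ℚ ({α} : Set ℂ)) = 0 := by
    apply (algebraMap (IntermediateField.adjoin ℚ ({α} : Set ℂ)) ℂ).injective
    simpa using hα
  refine ⟨cubicPoly.irreducible_rat hprime, hfin, fun v ↦ ?_,
    cubicPoly.not_isGalois hprime hn hsf hgen hfin, hK, ?_⟩
  · rw [InfinitePlace.isReal_iff, ComplexEmbedding.isReal_iff]
    let pb := IntermediateField.adjoin.powerBasis hint
    have key : (ComplexEmbedding.conjugate v.embedding).toRatAlgHom =
        v.embedding.toRatAlgHom := by
      apply pb.algHom_ext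
      rw [IntermediateField.adjoin.powerBasis_gen]
      apply cubicPoly.conj_eq_self_of_root hn
      simpa using congrArg v.embedding hgen
    ext x
    exact DFunLike.congr_fun key x
  · let θ : 𝓞 (IntermediateField.adjoin ℚ ({α} : Set ℂ)) :=
      ⟨IntermediateField.AdjoinSimple.gen ℚ α,
        ⟨_, cubicPoly.monic n, by rw [cubicPoly.eval₂_eq, hgen]⟩⟩
    refine cubicPoly.discr_eq (θ := θ) hprime hsf ?_
      (IntermediateField.adjoin.powerBasis hint) (IntermediateField.adjoin.powerBasis_gen hint)
    apply RingOfIntegers.coe_injective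
    simp only [map_add, map_sub, map_mul, map_pow, map_natCast, map_zero]
    exact hgen
end

section
/- Let n be a prime such that 4n² + 27 is squarefree, and let α be a root of h_n(x) = x³ + n·x² + n. Then h_n is irreducible over ℚ, K = ℚ(α) is a cubic field with exactly one real place and one complex place (not totally real), K is not Galois over ℚ, and the discriminant of K equals −n²·(4n² + 27). -/
open Polynomial NumberField

section Discriminant

variable {R S : Type*} [CommRing R] [CommRing S] [Algebra R S]

/-- The discriminant of a family differs from that of a basis by the square of a determinant
which multiplies the whole ring into the span of the family. -/
theorem exists_discr_eq_sq_mul_and_smul_mem_span {ι : Type*} [Fintype ι] [DecidableEq ι]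
    (b : Module.Basis ι R S) (e : ι → S) :
    ∃ d : R, Algebra.discr R e = d ^ 2 * Algebra.discr R b ∧
      ∀ z : S, d • z ∈ Submodule.span R (Set.range e) := by
  refine ⟨(b.toMatrix e).det, ?_, fun z ↦ ?_⟩
  · rw [← Algebra.discr_of_matrix_vecMul, b.toMatrix_map_vecMul]
  · have hb (k : ι) : (b.toMatrix e).det • b k = ∑ i, (b.toMatrix e).adjugate i k • e i := by
      simp_rw [← b.sum_toMatrix_smul_self e, Finset.smul_sum, smul_smul]
      rw [Finset.sum_comm]
      simp_rw [← Finset.sum_smul, mul_comm ((b.toMatrix e).adjugate _ k), ← Matrix.mul_apply,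
        Matrix.mul_adjugate, Matrix.smul_apply, Matrix.one_apply]
      simp
    rw [← b.sum_repr z, Finset.smul_sum]
    refine Submodule.sum_mem _ fun k _ ↦ ?_
    rw [smul_comm, hb]
    exact Submodule.smul_mem _ _ <| Submodule.sum_mem _ fun i _ ↦
      Submodule.smul_mem _ _ <| Submodule.subset_span ⟨i, rfl⟩

theorem discr_of_pow_three_add_mul_sq_add_eq_zero (b : Module.Basis (Fin 3) R S) {x : S} (a : R)
    (hb : ∀ i, b i = x ^ (i : ℕ)) (hx : x ^ 3 + algebraMap R S a * x ^ 2 + algebraMap R S a = 0) :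
    Algebra.discr R b = -(a ^ 2 * (4 * a ^ 2 + 27)) := by
  have h0 : b 0 = 1 := by simp [hb]
  have h1 : b 1 = x := by simp [hb]
  have h2 : b 2 = x ^ 2 := by simp [hb]
  have h3 : x ^ 3 = (-a) • b 2 + (-a) • b 0 := by
    rw [h0, h2]; simp only [Algebra.smul_def, map_neg]; linear_combination hx
  have h4 : x ^ 4 = (a ^ 2) • b 2 + (-a) • b 1 + a ^ 2 • b 0 := by
    rw [h0, h1, h2]; simp only [Algebra.smul_def, map_neg, map_pow]
    linear_combination (x - algebraMap R S a) * hx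
  have t0 : Algebra.trace R S 1 = 3 := by
    rw [Algebra.trace_eq_matrix_trace b]; simp
  have t1 : Algebra.trace R S x = -a := by
    rw [Algebra.trace_eq_matrix_trace b]
    simp only [Matrix.trace, Matrix.diag_apply, Algebra.leftMulMatrix_eq_repr_mul,
      Fin.sum_univ_three]
    rw [show x * b 0 = b 1 by rw [h0, h1, mul_one], show x * b 1 = b 2 by rw [h1, h2, sq],
      show x * b 2 = x ^ 3 by rw [h2]; ring, h3]
    simp
  have t2 : Algebra.trace R S (x ^ 2) = a ^ 2 := by
    rw [Algebra.trace_eq_matrix_trace b]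
    simp only [Matrix.trace, Matrix.diag_apply, Algebra.leftMulMatrix_eq_repr_mul,
      Fin.sum_univ_three]
    rw [show x ^ 2 * b 0 = b 2 by rw [h0, h2, mul_one],
      show x ^ 2 * b 1 = x ^ 3 by rw [h1]; ring, show x ^ 2 * b 2 = x ^ 4 by rw [h2]; ring, h3, h4]
    simp
  have t3 : Algebra.trace R S (x ^ 3) = -a ^ 3 - 3 * a := by
    rw [h3, h0, h2]; simp only [map_add, map_smul, t0, t2, smul_eq_mul]; ring
  have t4 : Algebra.trace R S (x ^ 4) = a ^ 4 + 4 * a ^ 2 := by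
    rw [h4, h0, h1, h2]; simp only [map_add, map_smul, t0, t1, t2, smul_eq_mul]; ring
  have hT (i j : Fin 3) : Algebra.traceMatrix R b i j = Algebra.trace R S (x ^ (i + j : ℕ)) := by
    rw [Algebra.traceMatrix_apply, Algebra.traceForm_apply, hb, hb, pow_add]
  rw [Algebra.discr_def, Matrix.det_fin_three]
  simp only [hT, Fin.val_zero, Fin.val_one, Fin.val_two, Nat.reduceAdd, pow_zero, pow_one,
    t0, t1, t2, t3, t4]
  ring

theorem coe_discr_int {K : Type*} [Field K] [NumberField K] {ι : Type*} [Fintype ι]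
    [DecidableEq ι] (e : ι → 𝓞 K) :
    (Algebra.discr ℤ e : ℚ) = Algebra.discr ℚ fun i ↦ (e i : K) := by
  rw [Algebra.discr_def, Algebra.discr_def, ← eq_intCast (Int.castRingHom ℚ), RingHom.map_det]
  congr 1
  ext i j
  simp [Algebra.traceMatrix_apply, Algebra.traceForm_apply, Algebra.coe_trace_int]

end Discriminant

section Cubic

variable {n : ℕ}

theorem monic_X_pow_three_add (R : Type*) [CommRing R] [Nontrivial R] (a : R) :
    (X ^ 3 + C a * X ^ 2 + C a).Monic := by
  monicity!

theorem natDegree_X_pow_three_add (R : Type*) [CommRing R] [Nontrivial R] (a : R) :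
    (X ^ 3 + C a * X ^ 2 + C a).natDegree = 3 := by
  compute_degree!

theorem isEisensteinAt_X_pow_three_add (hn : n.Prime) :
    (X ^ 3 + C (n : ℤ) * X ^ 2 + C (n : ℤ)).IsEisensteinAt (Submodule.span ℤ {(n : ℤ)}) := by
  have hp : Prime (n : ℤ) := Nat.prime_iff_prime_int.mp hn
  refine (monic_X_pow_three_add ℤ (n : ℤ)).isEisensteinAt_of_mem_of_notMem ?_ ?_ ?_
  · exact ((Ideal.span_singleton_prime hp.ne_zero).2 hp).ne_top
  · intro i hi
    rw [natDegree_X_pow_three_add] at hi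
    refine Ideal.mem_span_singleton.2 ?_
    interval_cases i <;> simp
  · intro h
    erw [Ideal.span_singleton_pow, Ideal.mem_span_singleton] at h
    simp only [coeff_add, coeff_X_pow, coeff_C_mul, coeff_C_zero] at h
    norm_num at h
    exact hp.not_isUnit (isUnit_of_dvd_one
      ((mul_dvd_mul_iff_left hp.ne_zero).1 (by rwa [mul_one, ← sq])))

theorem irreducible_X_pow_three_add_rat (hn : n.Prime) :
    Irreducible (X ^ 3 + C (n : ℚ) * X ^ 2 + C (n : ℚ)) := by
  have hp : Prime (n : ℤ) := Nat.prime_iff_prime_int.mp hn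
  have hm := monic_X_pow_three_add ℤ (n : ℤ)
  have h := (isEisensteinAt_X_pow_three_add hn).irreducible
    ((Ideal.span_singleton_prime hp.ne_zero).2 hp) hm.isPrimitive
    (by rw [natDegree_X_pow_three_add]; norm_num)
  simpa using (hm.irreducible_iff_irreducible_map_fraction_map (K := ℚ)).1 h

theorem minpoly_rat_eq_X_pow_three_add (hn : n.Prime) {L : Type*} [Field L] [CharZero L] {x : L}
    (hx : x ^ 3 + (n : L) * x ^ 2 + n = 0) :
    minpoly ℚ x = X ^ 3 + C (n : ℚ) * X ^ 2 + C (n : ℚ) :=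
  (minpoly.eq_of_irreducible_of_monic (irreducible_X_pow_three_add_rat hn) (by simpa using hx)
    (monic_X_pow_three_add ℚ _)).symm

theorem isIntegral_of_pow_three_add {L : Type*} [Field L] {x : L}
    (hx : x ^ 3 + (n : L) * x ^ 2 + n = 0) : IsIntegral ℤ x :=
  ⟨_, monic_X_pow_three_add ℤ (n : ℤ), by simpa using hx⟩

theorem minpoly_int_eq_X_pow_three_add (hn : n.Prime) {L : Type*} [Field L] [CharZero L] {x : L}
    (hx : x ^ 3 + (n : L) * x ^ 2 + n = 0) :
    minpoly ℤ x = X ^ 3 + C (n : ℤ) * X ^ 2 + C (n : ℤ) := by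
  apply map_injective (algebraMap ℤ ℚ) (algebraMap ℤ ℚ).injective_int
  rw [← minpoly.isIntegrallyClosed_eq_field_fractions' ℚ (isIntegral_of_pow_three_add hx),
    minpoly_rat_eq_X_pow_three_add hn hx]
  simp

variable {K : Type*} [Field K] [NumberField K]

theorem discr_of_powerBasis_pow_three_add (hn : n.Prime)
    (hsf : Squarefree (4 * (n : ℤ) ^ 2 + 27)) (B : PowerBasis ℚ K)
    (hB : B.gen ^ 3 + (n : K) * B.gen ^ 2 + n = 0) :
    NumberField.discr K = -((n : ℤ) ^ 2 * (4 * (n : ℤ) ^ 2 + 27)) := by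
  have hp : Prime (n : ℤ) := Nat.prime_iff_prime_int.mp hn
  have hint := isIntegral_of_pow_three_add hB
  have hmin := minpoly_int_eq_X_pow_three_add hn hB
  have hdim : B.dim = 3 := by
    rw [← B.natDegree_minpoly, minpoly_rat_eq_X_pow_three_add hn hB, natDegree_X_pow_three_add]
  obtain ⟨x, hx⟩ : ∃ x : 𝓞 K, (x : K) = B.gen := ⟨⟨B.gen, hint⟩, rfl⟩
  let e : Fin 3 → 𝓞 K := fun i ↦ x ^ (i : ℕ)
  let bK : Module.Basis (Fin 3) ℚ K := B.basis.reindex (finCongr hdim)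
  have hbK (i : Fin 3) : bK i = B.gen ^ (i : ℕ) := by simp [bK]
  have hbKe : (fun i ↦ (e i : K)) = bK := by ext i; simp [hbK, e, hx]
  have he : Algebra.discr ℤ e = -((n : ℤ) ^ 2 * (4 * (n : ℤ) ^ 2 + 27)) := by
    have := coe_discr_int e
    rw [hbKe, discr_of_pow_three_add_mul_sq_add_eq_zero bK (n : ℚ) hbK (by simpa using hB)] at this
    exact_mod_cast this
  have hcard : Fintype.card (Module.Free.ChooseBasisIndex ℤ (𝓞 K)) = 3 := by
    rw [← Module.finrank_eq_card_chooseBasisIndex, RingOfIntegers.rank, B.finrank, hdim]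
  let b : Module.Basis (Fin 3) ℤ (𝓞 K) :=
    (RingOfIntegers.basis K).reindex (Fintype.equivFinOfCardEq hcard)
  obtain ⟨d, hd, hmem⟩ := exists_discr_eq_sq_mul_and_smul_mem_span b e
  have hdn : d ∣ (n : ℤ) ^ 2 := by
    refine hsf.dvd_of_squarefree_of_mul_dvd_mul_left ?_
    rw [he, sq d] at hd
    exact (dvd_neg.1 (hd ▸ dvd_mul_right _ _))
  have hspan : Submodule.span ℤ (Set.range e) = Subalgebra.toSubmodule (Algebra.adjoin ℤ {x}) := by
    have hx0 : aeval x (X ^ 3 + C (n : ℤ) * X ^ 2 + C (n : ℤ)) = 0 := by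
      apply RingOfIntegers.coe_injective
      simpa [hx] using hB
    rw [← Submodule.span_range_natDegree_eq_adjoin (monic_X_pow_three_add ℤ (n : ℤ)) hx0,
      natDegree_X_pow_three_add]
    congr 1
    ext y
    simp [e, Fin.exists_iff]
  have htop : ⊤ ≤ Submodule.span ℤ (Set.range e) := by
    rintro z -
    have hz : (z : K) ∈ Algebra.adjoin ℤ {B.gen} := by
      refine mem_adjoin_of_smul_prime_pow_smul_of_minpoly_isEisensteinAt (n := 2) hp hint
        z.isIntegral_coe ?_ (hmin ▸ isEisensteinAt_X_pow_three_add hn)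
      obtain ⟨c, hc⟩ := hdn
      have hz' : (n : ℤ) ^ 2 • z ∈ Algebra.adjoin ℤ {x} := by
        rw [hc, mul_comm, mul_smul]
        exact Subalgebra.smul_mem _ (by simpa [hspan] using hmem z) c
      have := Subalgebra.mem_map (f := IsScalarTower.toAlgHom ℤ (𝓞 K) K) |>.2 ⟨_, hz', rfl⟩
      rw [AlgHom.map_adjoin_singleton] at this
      simpa [hx] using this
    rw [hspan, Subalgebra.mem_toSubmodule]
    rw [Algebra.adjoin_singleton_eq_range_aeval] at hz ⊢
    obtain ⟨P, hP⟩ := hz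
    refine ⟨P, RingOfIntegers.coe_injective ?_⟩
    refine Eq.trans ?_ hP
    simpa [hx] using (aeval_algebraMap_apply K x P).symm
  have hli : LinearIndependent ℤ e := by
    by_contra h
    have h0 := Algebra.discr_zero_of_not_linearIndependent ℤ h
    rw [he, neg_eq_zero] at h0
    have : (n : ℤ) ^ 2 ≠ 0 := pow_ne_zero _ hp.ne_zero
    exact (mul_ne_zero this hsf.ne_zero) h0
  rw [← NumberField.discr_eq_discr K (Module.Basis.mk hli htop), Module.Basis.coe_mk, he]

open scoped Classical in
theorem card_isReal_and_card_isComplex_eq_one_of_finrank_eq_three_of_discr_neg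
    (h3 : Module.finrank ℚ K = 3) (hd : NumberField.discr K < 0) :
    Nat.card {v : InfinitePlace K // v.IsReal} = 1 ∧
      Nat.card {v : InfinitePlace K // v.IsComplex} = 1 := by
  have hr : Nat.card {v : InfinitePlace K // v.IsReal} = InfinitePlace.nrRealPlaces K :=
    Nat.card_eq_fintype_card
  have hc : Nat.card {v : InfinitePlace K // v.IsComplex} = InfinitePlace.nrComplexPlaces K :=
    Nat.card_eq_fintype_card
  have hsum := InfinitePlace.card_add_two_mul_card_eq_rank K
  have hsign := NumberField.sign_discr K
  rw [Int.sign_eq_neg_one_of_neg hd] at hsign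
  have : InfinitePlace.nrComplexPlaces K ≠ 0 := by
    intro h0
    rw [h0] at hsign
    norm_num at hsign
  lia

/-- A Galois number field of odd degree is totally real. -/
theorem isReal_of_isGalois_of_odd_finrank [IsGalois ℚ K] (h : Odd (Module.finrank ℚ K))
    (v : InfinitePlace K) : v.IsReal := by
  have := IsUnramifiedAtInfinitePlaces_of_odd_finrank h
  have hv := InfinitePlace.isUnramified_iff.1 (NumberField.InfinitePlace.isUnramified ℚ v)
  refine hv.resolve_right fun hc ↦ ?_
  rw [← InfinitePlace.not_isReal_iff_isComplex] at hc
  rw [Subsingleton.elim (v.comap (algebraMap ℚ K)) Rat.infinitePlace] at hc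
  exact hc Rat.isReal_infinitePlace

end Cubic

/-- Let `n` be a prime with `4n² + 27` squarefree and `α` a root of
`hₙ(x) = x³ + n·x² + n`. Then `hₙ` is irreducible over `ℚ`, `K = ℚ(α)` is a cubic field
with exactly one real place and one complex place (not totally real), `K` is not Galois
over `ℚ`, and `D_K = −n²·(4n² + 27)`. -/
theorem stmt10 (n : ℕ) (hprime : n.Prime)
    (hsf : Squarefree (4 * (n : ℤ) ^ 2 + 27))
    (α : ℂ) (hα : α ^ 3 + (n : ℂ) * α ^ 2 + (n : ℂ) = 0) :
    Irreducible (X ^ 3 + C (n : ℚ) * X ^ 2 + C (n : ℚ)) ∧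
    Module.finrank ℚ (IntermediateField.adjoin ℚ ({α} : Set ℂ)) = 3 ∧
    Nat.card {v : InfinitePlace (IntermediateField.adjoin ℚ ({α} : Set ℂ)) // v.IsReal} = 1 ∧
    Nat.card {v : InfinitePlace (IntermediateField.adjoin ℚ ({α} : Set ℂ)) // v.IsComplex} = 1 ∧
    ¬ (∀ v : InfinitePlace (IntermediateField.adjoin ℚ ({α} : Set ℂ)), v.IsReal) ∧
    ¬ IsGalois ℚ (IntermediateField.adjoin ℚ ({α} : Set ℂ)) ∧
    ∃ hK : NumberField (IntermediateField.adjoin ℚ ({α} : Set ℂ)),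
      @NumberField.discr (IntermediateField.adjoin ℚ ({α} : Set ℂ)) _ hK =
        -((n : ℤ) ^ 2 * (4 * (n : ℤ) ^ 2 + 27)) := by
  have hirr := irreducible_X_pow_three_add_rat hprime
  have hαint : IsIntegral ℚ α := (isIntegral_of_pow_three_add hα).tower_top
  have hfin : Module.finrank ℚ (IntermediateField.adjoin ℚ ({α} : Set ℂ)) = 3 := by
    rw [IntermediateField.adjoin.finrank hαint, minpoly_rat_eq_X_pow_three_add hprime hα,
      natDegree_X_pow_three_add]
  have hK : NumberField (IntermediateField.adjoin ℚ ({α} : Set ℂ)) :=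
    { to_charZero := inferInstance
      to_finiteDimensional := IntermediateField.adjoin.finiteDimensional hαint }
  have hdiscr := discr_of_powerBasis_pow_three_add hprime hsf
    (IntermediateField.adjoin.powerBasis hαint) (by
      apply Subtype.val_injective
      simpa using hα)
  have hn : (0 : ℤ) < n := mod_cast hprime.pos
  obtain ⟨hr, hc⟩ := card_isReal_and_card_isComplex_eq_one_of_finrank_eq_three_of_discr_neg hfin
    (by rw [hdiscr, neg_lt_zero]; positivity)
  have hnotreal : ¬ ∀ v : InfinitePlace (IntermediateField.adjoin ℚ ({α} : Set ℂ)), v.IsReal := by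
    intro h
    obtain ⟨v, hv⟩ := (Nat.card_pos_iff.1 (hc ▸ Nat.one_pos)).1
    exact InfinitePlace.not_isReal_iff_isComplex.2 hv (h v)
  refine ⟨hirr, hfin, hr, hc, hnotreal, fun hG ↦ hnotreal fun v ↦ ?_, hK, hdiscr⟩
  exact isReal_of_isGalois_of_odd_finrank (by rw [hfin]; decide) v
end
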